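/- Let K₀ ∈ S and let K : [0, ∞) → S solve the gradient flow K'(t) = −∇f(K(t)), K(0) = K₀. Then the trajectory is exponentially stable in the sense of Lyapunov: there exist constants c > 0 and α > 0 (depending only on A, B, Q, R, Σ and K₀) such that ‖K(t) − K_*‖_F² ≤ c e^{−αt} ‖K₀ − K_*‖_F² for all t ≥ 0. -/

import Mathlib

open Matrix

attribute [local instance] Matrix.normedAddCommGroup Matrix.normedSpace

/-- `M` is Schur stable: spectral radius `ρ(M) < 1`. -/
def IsSchur {k : ℕ} (M : Matrix (Fin k) (Fin k) ℝ) : Prop :=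
  ∀ μ ∈ spectrum ℂ (M.map (Complex.ofReal ·)), ‖μ‖ < 1

/-- The Frobenius norm of a real matrix. -/
noncomputable def frobNorm {a b : ℕ} (K : Matrix (Fin a) (Fin b) ℝ) : ℝ :=
  Real.sqrt (∑ i, ∑ j, (K i j) ^ 2)

open Filter Topology

/-- Powers of an element of a finite-dimensional complex normed algebra whose spectrum lies
in the open unit disc tend to zero. -/
theorem tendsto_pow_of_spectrum_norm_lt_one {𝔸 : Type*} [NormedRing 𝔸] [NormedAlgebra ℂ 𝔸]
    [FiniteDimensional ℂ 𝔸] (a : 𝔸) (h : ∀ μ ∈ spectrum ℂ a, ‖μ‖ < 1) :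
    Tendsto (fun k : ℕ => a ^ k) atTop (𝓝 0) := by
  have := FiniteDimensional.complete ℂ 𝔸
  rcases subsingleton_or_nontrivial 𝔸 with h0 | h0
  · exact tendsto_const_nhds.congr fun k => Subsingleton.elim _ _
  have hr : spectralRadius ℂ a < 1 := by
    simpa using spectrum.spectralRadius_lt_of_forall_lt a (r := 1) (fun z hz => by
      simpa [← NNReal.coe_lt_coe] using h z hz)
  obtain ⟨r, hr1, hr2⟩ := ENNReal.lt_iff_exists_nnreal_btwn.1 hr
  have hr2' : r < 1 := by exact_mod_cast hr2
  have ht := (spectrum.pow_nnnorm_pow_one_div_tendsto_nhds_spectralRadius a).eventually_lt_const hr1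
  refine squeeze_zero_norm' (a := fun k => (r : ℝ) ^ k) ?_
    (tendsto_pow_atTop_nhds_zero_of_lt_one r.2 (by exact_mod_cast hr2'))
  filter_upwards [ht, eventually_gt_atTop 0] with k hk hk0
  have hk' : (0 : ℝ) < k := by exact_mod_cast hk0
  have h1 := ENNReal.rpow_lt_rpow hk hk'
  rw [← ENNReal.rpow_mul, one_div, inv_mul_cancel₀ hk'.ne', ENNReal.rpow_one,
    ENNReal.rpow_natCast] at h1
  have : ‖a ^ k‖₊ < r ^ k := by exact_mod_cast h1
  exact_mod_cast this.le

theorem eventually_spectrum_norm_lt_one {𝔸 : Type*} [NormedRing 𝔸] [NormedAlgebra ℂ 𝔸]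
    [FiniteDimensional ℂ 𝔸] (a : 𝔸) (h : ∀ μ ∈ spectrum ℂ a, ‖μ‖ < 1) :
    ∀ᶠ b in 𝓝 a, ∀ μ ∈ spectrum ℂ b, ‖μ‖ < 1 := by
  have := FiniteDimensional.complete ℂ 𝔸
  have hs := upperHemicontinuous_spectrum ℂ 𝔸 a (Metric.ball 0 1)
    (Metric.isOpen_ball.mem_nhdsSet.2 fun μ hμ => by simpa using h μ hμ)
  filter_upwards [hs] with b hb μ hμ
  simpa using subset_of_mem_nhdsSet hb hμ

theorem IsSchur.tendsto_pow {k : ℕ} {M : Matrix (Fin k) (Fin k) ℝ} (hM : IsSchur M) :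
    Tendsto (fun i : ℕ => M ^ i) atTop (𝓝 0) := by
  have h : Tendsto (fun i : ℕ => (M.map (Complex.ofReal ·)) ^ i) atTop (𝓝 0) := by
    let := Matrix.linftyOpNormedRing (n := Fin k) (α := ℂ)
    let := Matrix.linftyOpNormedAlgebra (R := ℂ) (n := Fin k) (α := ℂ)
    exact tendsto_pow_of_spectrum_norm_lt_one _ hM
  have h2 := ((continuous_id.matrix_map Complex.continuous_re).tendsto _).comp h
  have h3 : ((0 : Matrix (Fin k) (Fin k) ℂ)).map Complex.re = 0 := by ext; simp
  simp only [id, h3] at h2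
  refine h2.congr fun i => ?_
  have : (M.map (Complex.ofReal ·)) ^ i = (M ^ i).map (Complex.ofReal ·) :=
    (map_pow (Complex.ofRealHom.mapMatrix (m := Fin k)) M i).symm
  simp only [Function.comp, this]
  ext; simp

/-- Schur stability is an open condition. -/
theorem IsSchur.eventually {k : ℕ} {M : Matrix (Fin k) (Fin k) ℝ} (hM : IsSchur M) :
    ∀ᶠ N in 𝓝 M, IsSchur N := by
  have h : ∀ᶠ N : Matrix (Fin k) (Fin k) ℂ in 𝓝 (M.map (Complex.ofReal ·)),
      ∀ μ ∈ spectrum ℂ N, ‖μ‖ < 1 := by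
    let := Matrix.linftyOpNormedRing (n := Fin k) (α := ℂ)
    let := Matrix.linftyOpNormedAlgebra (R := ℂ) (n := Fin k) (α := ℂ)
    exact eventually_spectrum_norm_lt_one _ hM
  exact ((continuous_id.matrix_map Complex.continuous_ofReal).tendsto M).eventually h

theorem eq_pow_mul_mul_of_fixed {k : ℕ} {M Z : Matrix (Fin k) (Fin k) ℝ} (h : M * Z * Mᵀ = Z)
    (i : ℕ) : M ^ i * Z * (M ^ i)ᵀ = Z := by
  induction i with
  | zero => simp
  | succ i ih =>
    calc M ^ (i + 1) * Z * (M ^ (i + 1))ᵀ = M ^ i * (M * Z * Mᵀ) * (M ^ i)ᵀ := by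
          simp only [pow_succ, transpose_mul, Matrix.mul_assoc]
      _ = Z := by rw [h, ih]

theorem IsSchur.tendsto_pow_mul_mul {k : ℕ} {M : Matrix (Fin k) (Fin k) ℝ} (hM : IsSchur M)
    (Z : Matrix (Fin k) (Fin k) ℝ) :
    Tendsto (fun i : ℕ => M ^ i * Z * (M ^ i)ᵀ) atTop (𝓝 0) := by
  have hc : Continuous fun N : Matrix (Fin k) (Fin k) ℝ => N * Z * Nᵀ := by fun_prop
  simpa [Function.comp_def] using (hc.tendsto 0).comp hM.tendsto_pow

theorem IsSchur.eq_zero_of_fixed {k : ℕ} {M Z : Matrix (Fin k) (Fin k) ℝ} (hM : IsSchur M)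
    (h : M * Z * Mᵀ = Z) : Z = 0 :=
  tendsto_nhds_unique tendsto_const_nhds
    ((hM.tendsto_pow_mul_mul Z).congr (eq_pow_mul_mul_of_fixed h))

theorem IsSchur.posSemidef_of_lyapunov {k : ℕ} {M Z W : Matrix (Fin k) (Fin k) ℝ}
    (hM : IsSchur M) (hW : W.PosSemidef) (h : M * Z * Mᵀ + W = Z) : Z.PosSemidef := by
  have hWt : Wᵀ = W := hW.isHermitian
  have hsymm : Zᵀ = Z := by
    have h1 : M * (Zᵀ - Z) * Mᵀ = Zᵀ - Z := by
      conv_rhs => rw [← h]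
      simp only [transpose_add, transpose_mul, transpose_transpose, hWt, Matrix.mul_sub,
        Matrix.sub_mul, Matrix.mul_assoc]
      abel
    exact sub_eq_zero.1 (hM.eq_zero_of_fixed h1)
  have hdiff : ∀ i : ℕ, (Z - M ^ i * Z * (M ^ i)ᵀ).PosSemidef := by
    intro i
    induction i with
    | zero => simpa using PosSemidef.zero
    | succ i ih =>
      have h2 : Z - M ^ (i + 1) * Z * (M ^ (i + 1))ᵀ
          = (Z - M ^ i * Z * (M ^ i)ᵀ) + M ^ i * W * (M ^ i)ᵀ := by
        have h3 : W = Z - M * Z * Mᵀ := eq_sub_of_add_eq' h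
        rw [h3]
        simp only [pow_succ, transpose_mul, Matrix.mul_assoc, Matrix.mul_sub, Matrix.sub_mul]
        abel
      rw [h2]
      exact ih.add (hW.mul_mul_conjTranspose_same _)
  refine .of_dotProduct_mulVec_nonneg hsymm fun x => ?_
  have hc : Continuous fun N : Matrix (Fin k) (Fin k) ℝ => star x ⬝ᵥ (Z - N) *ᵥ x := by fun_prop
  have ht := (hc.tendsto 0).comp (hM.tendsto_pow_mul_mul Z)
  rw [sub_zero] at ht
  exact ge_of_tendsto' ht fun i => (hdiff i).dotProduct_mulVec_nonneg x

theorem IsSchur.transpose {k : ℕ} {M : Matrix (Fin k) (Fin k) ℝ} (hM : IsSchur M) :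
    IsSchur Mᵀ := by
  intro μ hμ
  refine hM μ ?_
  change μ ∈ spectrum ℂ (M.map (Complex.ofReal ·))ᵀ at hμ
  rw [Matrix.mem_spectrum_iff_isRoot_charpoly, Matrix.charpoly_transpose] at hμ
  rwa [Matrix.mem_spectrum_iff_isRoot_charpoly]

theorem continuous_of_linearMap_apply_eq {E α : Type*} [NormedAddCommGroup E] [NormedSpace ℝ E]
    [FiniteDimensional ℝ E] [TopologicalSpace α] {L : α → E →ₗ[ℝ] E}
    (hL : ∀ v, Continuous fun y => L y v) (hinj : ∀ y, Function.Injective (L y))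
    {Z : α → E} {w : E} (h : ∀ y, L y (Z y) = w) : Continuous Z := by
  have := FiniteDimensional.complete ℝ E
  let F : α → E →L[ℝ] E := fun y => (L y).toContinuousLinearMap
  have hF : Continuous F := continuous_clm_apply.2 hL
  have hU : ∀ y, IsUnit (F y) := fun y => by
    let e := (LinearEquiv.ofInjectiveEndo _ (hinj y)).toContinuousLinearEquiv
    exact ⟨ContinuousLinearEquiv.toUnit e, by ext1; rfl⟩
  have hZ : Z = fun y => Ring.inverse (F y) w := by
    ext1 y
    rw [← h y]
    change Z y = (Ring.inverse (F y) * F y) (Z y)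
    rw [Ring.inverse_mul_cancel _ (hU y)]
    rfl
  rw [hZ]
  refine Continuous.clm_apply (continuous_iff_continuousAt.2 fun y => ?_) continuous_const
  obtain ⟨u, hu⟩ := hU y
  have h1 : ContinuousAt Ring.inverse (F y) := hu ▸ NormedRing.inverse_continuousAt u
  exact ContinuousAt.comp (f := F) h1 hF.continuousAt

/-- Solutions of the Lyapunov equation depend continuously on the Schur stable matrix. -/
theorem continuousOn_lyapunov {k : ℕ} {s : Set ℝ} {M Z : ℝ → Matrix (Fin k) (Fin k) ℝ}
    {W : Matrix (Fin k) (Fin k) ℝ} (hMc : ContinuousOn M s) (hM : ∀ t ∈ s, IsSchur (M t))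
    (h : ∀ t ∈ s, M t * Z t * (M t)ᵀ + W = Z t) : ContinuousOn Z s := by
  rw [continuousOn_iff_continuous_domRestrict] at hMc ⊢
  refine continuous_of_linearMap_apply_eq (w := W)
    (L := fun t : s => LinearMap.id - LinearMap.mulRight ℝ (M t)ᵀ ∘ₗ LinearMap.mulLeft ℝ (M t))
    (fun v => ?_) (fun t => ?_) fun t => ?_
  · change Continuous fun t : s => v - M t * v * (M t)ᵀ
    have hMc' : Continuous fun t : s => M t := hMc
    exact continuous_const.sub
      ((hMc'.matrix_mul continuous_const).matrix_mul hMc'.matrix_transpose)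
  · refine (injective_iff_map_eq_zero _).2 fun Z hZ => (hM t t.2).eq_zero_of_fixed ?_
    exact (sub_eq_zero.1 hZ).symm
  · exact sub_eq_iff_eq_add'.2 (h t t.2).symm

theorem Matrix.IsHermitian.posSemidef_sub_smul_one {k : ℕ} {P : Matrix (Fin k) (Fin k) ℝ}
    (hP : P.IsHermitian) {p : ℝ} (hp : ∀ i, p ≤ hP.eigenvalues i) :
    (P - p • (1 : Matrix (Fin k) (Fin k) ℝ)).PosSemidef := by
  have h : P - p • (1 : Matrix (Fin k) (Fin k) ℝ)
      = Unitary.conjStarAlgAut ℝ (Matrix (Fin k) (Fin k) ℝ) hP.eigenvectorUnitary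
        (diagonal fun i => hP.eigenvalues i - p) := by
    have h1 : (diagonal fun i => hP.eigenvalues i - p)
        = diagonal (RCLike.ofReal ∘ hP.eigenvalues) - p • (1 : Matrix (Fin k) (Fin k) ℝ) := by
      ext i j
      by_cases hij : i = j <;> simp [hij, diagonal]
    rw [h1, map_sub, map_smul, map_one, ← hP.spectral_theorem]
  rw [h, Unitary.conjStarAlgAut_apply]
  exact (PosSemidef.diagonal fun i => sub_nonneg.2 (hp i)).mul_mul_conjTranspose_same _

theorem Matrix.PosDef.exists_posSemidef_sub_smul_one {k : ℕ} {P : Matrix (Fin k) (Fin k) ℝ}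
    (hP : P.PosDef) : ∃ p > (0 : ℝ), (P - p • (1 : Matrix (Fin k) (Fin k) ℝ)).PosSemidef := by
  rcases isEmpty_or_nonempty (Fin k) with h | h
  · exact ⟨1, one_pos, hP.isHermitian.posSemidef_sub_smul_one fun i => isEmptyElim i⟩
  · obtain ⟨i, hi⟩ := Finite.exists_min hP.isHermitian.eigenvalues
    exact ⟨_, hP.eigenvalues_pos i, hP.isHermitian.posSemidef_sub_smul_one hi⟩

theorem Matrix.IsHermitian.exists_posSemidef_smul_one_sub {k : ℕ}
    {P : Matrix (Fin k) (Fin k) ℝ} (hP : P.IsHermitian) :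
    ∃ p > (0 : ℝ), (p • (1 : Matrix (Fin k) (Fin k) ℝ) - P).PosSemidef := by
  obtain ⟨c, hc⟩ := (Set.finite_range hP.neg.eigenvalues).bddBelow
  refine ⟨max 1 (-c), by positivity, ?_⟩
  have h := hP.neg.posSemidef_sub_smul_one (p := -max 1 (-c)) fun i =>
    (neg_le.1 (le_max_right _ _)).trans (hc ⟨i, rfl⟩)
  convert h using 1
  rw [neg_smul]
  abel

open scoped MatrixOrder in
theorem Matrix.PosSemidef.trace_mul_nonneg {k : ℕ} {P W : Matrix (Fin k) (Fin k) ℝ}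
    (hP : P.PosSemidef) (hW : W.PosSemidef) : 0 ≤ trace (P * W) := by
  obtain ⟨C, rfl⟩ := CStarAlgebra.nonneg_iff_eq_star_mul_self.1 hP.nonneg
  rw [star_eq_conjTranspose, Matrix.trace_mul_comm, ← Matrix.mul_assoc,
    Matrix.trace_mul_comm, ← Matrix.mul_assoc]
  exact (hW.mul_mul_conjTranspose_same C).trace_nonneg

theorem trace_mul_eq_of_lyapunov {k : ℕ} {D N W Z : Matrix (Fin k) (Fin k) ℝ}
    (h : N * Z * Nᵀ + W = Z) : trace (D * W) = trace ((D - Nᵀ * D * N) * Z) := by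
  have h1 : trace (Nᵀ * D * N * Z) = trace (D * (N * Z * Nᵀ)) := by
    rw [Matrix.mul_assoc, Matrix.mul_assoc, Matrix.trace_mul_comm]
    simp only [Matrix.mul_assoc]
  rw [Matrix.sub_mul, trace_sub, h1, ← trace_sub, ← Matrix.mul_sub]
  rw [sub_eq_of_eq_add' h.symm]

/-- The difference of the LQR costs of the gains `K + Δ` and `K`, in terms of the closed loop
matrices `M = A - B K` and `M - B Δ`. -/
theorem lqr_cost_sub {n m : ℕ} {B : Matrix (Fin n) (Fin m) ℝ} {R : Matrix (Fin m) (Fin m) ℝ}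
    {Q Sig M X X' Y' : Matrix (Fin n) (Fin n) ℝ} {K Δ : Matrix (Fin m) (Fin n) ℝ}
    (hR : Rᵀ = R) (hXt : Xᵀ = X)
    (hX : Mᵀ * X * M + Kᵀ * R * K + Q = X)
    (hX' : (M - B * Δ)ᵀ * X' * (M - B * Δ) + (K + Δ)ᵀ * R * (K + Δ) + Q = X')
    (hY' : (M - B * Δ) * Y' * (M - B * Δ)ᵀ + Sig = Y') :
    trace (X' * Sig) - trace (X * Sig)
      = trace ((Δᵀ * (R * K - Bᵀ * X * M) + (R * K - Bᵀ * X * M)ᵀ * Δ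
          + Δᵀ * (R + Bᵀ * X * B) * Δ) * Y') := by
  have hD : (X' - X) - (M - B * Δ)ᵀ * (X' - X) * (M - B * Δ)
      = Δᵀ * (R * K - Bᵀ * X * M) + (R * K - Bᵀ * X * M)ᵀ * Δ
          + Δᵀ * (R + Bᵀ * X * B) * Δ := by
    have h1 : (M - B * Δ)ᵀ * (X' - X) * (M - B * Δ)
        = (M - B * Δ)ᵀ * X' * (M - B * Δ) - (M - B * Δ)ᵀ * X * (M - B * Δ) := by
      rw [← Matrix.sub_mul, ← Matrix.mul_sub]
    have h2 : (M - B * Δ)ᵀ * X' * (M - B * Δ) = X' - ((K + Δ)ᵀ * R * (K + Δ) + Q) := by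
      rw [eq_sub_iff_add_eq, ← add_assoc, hX']
    have h3 : Mᵀ * (X * M) = X - (Kᵀ * (R * K) + Q) := by
      rw [eq_sub_iff_add_eq, ← add_assoc, ← Matrix.mul_assoc, ← Matrix.mul_assoc, hX]
    rw [h1, h2]
    simp only [transpose_sub, transpose_add, transpose_mul, transpose_transpose, hR, hXt,
      Matrix.mul_sub, Matrix.sub_mul, Matrix.mul_add, Matrix.add_mul, Matrix.mul_assoc, h3]
    abel
  rw [← trace_sub, ← Matrix.sub_mul, trace_mul_eq_of_lyapunov hY', hD]

theorem neg_trace_le_of_posSemidef {n m : ℕ} {H : Matrix (Fin m) (Fin m) ℝ} {r y : ℝ}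
    {Y : Matrix (Fin n) (Fin n) ℝ} (hr : 0 < r)
    (hH : (H - r • (1 : Matrix (Fin m) (Fin m) ℝ)).PosSemidef)
    (hY : Y.PosSemidef) (hy : (y • (1 : Matrix (Fin n) (Fin n) ℝ) - Y).PosSemidef)
    (E Δ : Matrix (Fin m) (Fin n) ℝ) :
    -trace ((Δᵀ * E + Eᵀ * Δ + Δᵀ * H * Δ) * Y) ≤ r⁻¹ * y * trace (Eᵀ * E) := by
  have h1 := (hH.conjTranspose_mul_mul_same Δ).trace_mul_nonneg hY
  have h2 := ((posSemidef_conjTranspose_mul_self (r • Δ + E)).trace_mul_nonneg hY)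
  have h3 := (posSemidef_conjTranspose_mul_self E).trace_mul_nonneg hy
  simp only [conjTranspose_eq_transpose_of_trivial, transpose_add, transpose_smul, Matrix.mul_add,
    Matrix.add_mul, Matrix.mul_sub, Matrix.sub_mul, Matrix.smul_mul, Matrix.mul_smul, trace_add,
    trace_sub, trace_smul, Matrix.mul_one, smul_eq_mul] at h1 h2 h3 ⊢
  have h4 : 0 ≤ r⁻¹ * (r * (r * trace (Δᵀ * Δ * Y)) + r * trace (Δᵀ * E * Y)
      + (r * trace (Eᵀ * Δ * Y) + trace (Eᵀ * E * Y))) := by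
    refine mul_nonneg (by positivity) ?_
    linarith
  have h5 : 0 ≤ r⁻¹ * (y * trace (Eᵀ * E) - trace (Eᵀ * E * Y)) :=
    mul_nonneg (by positivity) h3
  have h6 : r⁻¹ * r = 1 := inv_mul_cancel₀ hr.ne'
  linear_combination h1 + h4 + h5
    + (r * trace (Δᵀ * Δ * Y) + trace (Δᵀ * E * Y) + trace (Eᵀ * Δ * Y)) * h6

theorem sq_mul_trace_le_trace_mul {n m : ℕ} {s : ℝ} {Y : Matrix (Fin n) (Fin n) ℝ} (hs : 0 ≤ s)
    (hY : (Y - s • (1 : Matrix (Fin n) (Fin n) ℝ)).PosSemidef) (E : Matrix (Fin m) (Fin n) ℝ) :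
    s ^ 2 * trace (Eᵀ * E) ≤ trace ((E * Y)ᵀ * (E * Y)) := by
  have hYt : Yᵀ = Y := by
    have h := hY.isHermitian.eq
    simpa using h
  have h1 := (posSemidef_conjTranspose_mul_self
    (E * (Y - s • (1 : Matrix (Fin n) (Fin n) ℝ)))).trace_nonneg
  have h2 := (posSemidef_conjTranspose_mul_self E).trace_mul_nonneg hY
  have h3 : trace (Y * (Eᵀ * E)) = trace (Eᵀ * (E * Y)) := by
    rw [Matrix.trace_mul_comm, Matrix.mul_assoc]
  simp only [conjTranspose_eq_transpose_of_trivial, transpose_mul, transpose_sub, transpose_smul,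
    hYt, Matrix.mul_sub, Matrix.sub_mul, Matrix.smul_mul, Matrix.mul_smul,
    trace_sub, trace_smul, Matrix.mul_one, smul_eq_mul, Matrix.mul_assoc, h3]
    at h1 h2 ⊢
  nlinarith [mul_nonneg hs h2]

theorem smul_trace_le_trace_mul {n m : ℕ} {r s : ℝ} {H : Matrix (Fin m) (Fin m) ℝ}
    {Y : Matrix (Fin n) (Fin n) ℝ} (hr : 0 ≤ r) (hs : 0 ≤ s)
    (hH : (H - r • (1 : Matrix (Fin m) (Fin m) ℝ)).PosSemidef)
    (hY : (Y - s • (1 : Matrix (Fin n) (Fin n) ℝ)).PosSemidef) (Δ : Matrix (Fin m) (Fin n) ℝ) :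
    r * s * trace (Δᵀ * Δ) ≤ trace (Δᵀ * H * Δ * Y) := by
  have hY0 : Y.PosSemidef := by
    simpa using hY.add (PosSemidef.one.smul hs)
  have h1 := (hH.conjTranspose_mul_mul_same Δ).trace_mul_nonneg hY0
  have h2 := (posSemidef_conjTranspose_mul_self Δ).trace_mul_nonneg hY
  simp only [conjTranspose_eq_transpose_of_trivial, Matrix.mul_sub, Matrix.sub_mul,
    Matrix.smul_mul, Matrix.mul_smul, trace_sub, trace_smul, Matrix.mul_one, smul_eq_mul] at h1 h2
  nlinarith [mul_nonneg hr h2]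

theorem frobNorm_sq {a b : ℕ} (K : Matrix (Fin a) (Fin b) ℝ) :
    frobNorm K ^ 2 = trace (Kᵀ * K) := by
  rw [frobNorm, Real.sq_sqrt (by positivity), Finset.sum_comm]
  simp [trace, Matrix.mul_apply, sq]

/-- The gradient of the LQR cost vanishes at a global minimizer. -/
theorem lqr_gradient_eq_zero {n m : ℕ} {H : Matrix (Fin m) (Fin m) ℝ} {s : ℝ} (hs : 0 < s)
    (hH : H.IsHermitian) {E : Matrix (Fin m) (Fin n) ℝ}
    (h : ∀ᶠ ε in 𝓝 (0 : ℝ), ∃ Y : Matrix (Fin n) (Fin n) ℝ,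
      (Y - s • (1 : Matrix (Fin n) (Fin n) ℝ)).PosSemidef ∧
      0 ≤ trace (((-ε • E)ᵀ * E + Eᵀ * (-ε • E) + (-ε • E)ᵀ * H * (-ε • E)) * Y)) :
    E = 0 := by
  obtain ⟨c, hc, hcH⟩ := hH.exists_posSemidef_smul_one_sub
  have h1 : ∀ᶠ ε in 𝓝 (0 : ℝ), ε < c⁻¹ := eventually_lt_nhds (inv_pos.2 hc)
  obtain ⟨ε, ⟨⟨Y, hY, hE⟩, hε⟩, hε0⟩ :=
    (((h.and h1).filter_mono nhdsWithin_le_nhds).and (self_mem_nhdsWithin (s := Set.Ioi 0))).exists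
  replace hε0 : 0 < ε := hε0
  have hεc : ε * c ≤ 1 := (le_inv_mul_iff₀' hc).1 (by simpa using hε.le)
  have hY0 : Y.PosSemidef := by
    simpa using hY.add (PosSemidef.one.smul hs.le)
  have h2 := (hcH.conjTranspose_mul_mul_same E).trace_mul_nonneg hY0
  have h3 := (posSemidef_conjTranspose_mul_self E).trace_mul_nonneg hY
  have h4 := (posSemidef_conjTranspose_mul_self E).trace_nonneg
  simp only [conjTranspose_eq_transpose_of_trivial, transpose_smul, Matrix.mul_sub,
    Matrix.sub_mul, Matrix.add_mul, trace_add,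
    Matrix.smul_mul, Matrix.mul_smul, trace_sub, trace_smul, Matrix.mul_one, smul_eq_mul]
    at h2 h3 h4 hE
  refine trace_conjTranspose_mul_self_eq_zero_iff.1 ?_
  rw [conjTranspose_eq_transpose_of_trivial]
  have h5 : 0 ≤ trace (Eᵀ * E * Y) := by nlinarith
  have h6 : 0 ≤ ε * (-2 + ε * c) * trace (Eᵀ * E * Y) := by
    nlinarith [mul_nonneg (mul_nonneg hε0.le hε0.le) h2]
  have h7 : trace (Eᵀ * E * Y) ≤ 0 := by
    by_contra! h8
    have : 0 < ε * (2 - ε * c) * trace (Eᵀ * E * Y) :=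
      mul_pos (mul_pos hε0 (by linarith)) h8
    linarith
  nlinarith


theorem hasDerivWithinAt_of_trace_increment {n m : ℕ} {g : ℝ → ℝ} {s : Set ℝ} {t : ℝ}
    {κ : ℝ → Matrix (Fin m) (Fin n) ℝ} {κ' E : Matrix (Fin m) (Fin n) ℝ}
    {H : Matrix (Fin m) (Fin m) ℝ} {Z : ℝ → Matrix (Fin n) (Fin n) ℝ}
    (hκ : HasDerivWithinAt κ κ' s t) (hZ : ContinuousWithinAt Z s t)
    (hg : ∀ u ∈ s, g u - g t = trace (((κ u - κ t)ᵀ * E + Eᵀ * (κ u - κ t)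
      + (κ u - κ t)ᵀ * H * (κ u - κ t)) * Z u)) :
    HasDerivWithinAt g (trace ((κ'ᵀ * E + Eᵀ * κ') * Z t)) s t := by
  rw [hasDerivWithinAt_iff_tendsto_slope]
  have h1 := hasDerivWithinAt_iff_tendsto_slope.1 hκ
  have hsub : 𝓝[s \ {t}] t ≤ 𝓝[s] t := nhdsWithin_mono _ Set.sdiff_subset
  have h2 : Tendsto (fun u => κ u - κ t) (𝓝[s \ {t}] t) (𝓝 0) := by
    have h := (hκ.continuousWithinAt.tendsto.mono_left hsub).sub_const (κ t)
    rwa [sub_self] at h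
  have h3 : Tendsto Z (𝓝[s \ {t}] t) (𝓝 (Z t)) := hZ.tendsto.mono_left hsub
  have hc : Continuous fun p : Matrix (Fin m) (Fin n) ℝ × Matrix (Fin m) (Fin n) ℝ ×
      Matrix (Fin n) (Fin n) ℝ =>
      trace ((p.1ᵀ * E + Eᵀ * p.1 + p.1ᵀ * H * p.2.1) * p.2.2) := by fun_prop
  have h4 := (hc.tendsto (κ', 0, Z t)).comp (h1.prodMk_nhds (h2.prodMk_nhds h3))
  simp only [Matrix.mul_zero, add_zero] at h4
  refine h4.congr' ?_
  filter_upwards [self_mem_nhdsWithin] with u hu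
  simp only [Function.comp, slope, vsub_eq_sub]
  rw [hg u hu.1, ← trace_smul]
  simp only [transpose_smul, Matrix.smul_mul, Matrix.mul_smul, smul_add, Matrix.add_mul]

theorem le_exp_mul_of_hasDerivWithinAt_le {g g' : ℝ → ℝ} {α : ℝ}
    (hg : ∀ t ∈ Set.Ici (0 : ℝ), HasDerivWithinAt g (g' t) (Set.Ici 0) t)
    (hle : ∀ t ∈ Set.Ici (0 : ℝ), g' t ≤ -α * g t) {t : ℝ} (ht : t ∈ Set.Ici (0 : ℝ)) :
    g t ≤ Real.exp (-α * t) * g 0 := by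
  have hderiv : ∀ t ∈ Set.Ici (0 : ℝ), HasDerivWithinAt (fun t => Real.exp (α * t) * g t)
      (Real.exp (α * t) * α * g t + Real.exp (α * t) * g' t) (Set.Ici 0) t := fun t ht => by
    have h1 : HasDerivAt (fun t => Real.exp (α * t)) (Real.exp (α * t) * α) t := by
      simpa using ((hasDerivAt_id t).const_mul α).exp
    exact h1.hasDerivWithinAt.mul (hg t ht)
  have hanti : AntitoneOn (fun t => Real.exp (α * t) * g t) (Set.Ici 0) := by
    refine antitoneOn_of_hasDerivWithinAt_nonpos (convex_Ici 0)
      (fun t ht => (hderiv t ht).continuousWithinAt)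
      (fun t ht => (hderiv t (interior_subset ht)).mono interior_subset) fun t ht => ?_
    have h2 := hle t (interior_subset ht)
    nlinarith [mul_le_mul_of_nonneg_left h2 (Real.exp_pos (α * t)).le]
  have h3 := hanti Set.self_mem_Ici ht ht
  simp only [mul_zero, Real.exp_zero, one_mul] at h3
  have h4 : Real.exp (-α * t) * Real.exp (α * t) = 1 := by
    rw [← Real.exp_add]
    simp
  calc g t = Real.exp (-α * t) * (Real.exp (α * t) * g t) := by rw [← mul_assoc, h4, one_mul]
    _ ≤ Real.exp (-α * t) * g 0 := mul_le_mul_of_nonneg_left h3 (Real.exp_pos _).le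

theorem stmt11 {n m : ℕ} (hn : 0 < n) (hm : 0 < m)
    (A : Matrix (Fin n) (Fin n) ℝ) (B : Matrix (Fin n) (Fin m) ℝ)
    (Q Sig : Matrix (Fin n) (Fin n) ℝ) (R : Matrix (Fin m) (Fin m) ℝ)
    (hQ : Q.PosDef) (hR : R.PosDef) (hSig : Sig.PosDef)
    (X : Matrix (Fin m) (Fin n) ℝ → Matrix (Fin n) (Fin n) ℝ)
    (Y : Matrix (Fin m) (Fin n) ℝ → Matrix (Fin n) (Fin n) ℝ)
    (hX : ∀ K, IsSchur (A - B * K) →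
      (A - B * K)ᵀ * X K * (A - B * K) + Kᵀ * R * K + Q = X K)
    (hY : ∀ K, IsSchur (A - B * K) →
      (A - B * K) * Y K * (A - B * K)ᵀ + Sig = Y K)
    -- `Kstar` is the global minimizer of `f` over `S`
    (Kstar : Matrix (Fin m) (Fin n) ℝ) (hKstar : IsSchur (A - B * Kstar))
    (hmin : ∀ K, IsSchur (A - B * K) →
      Matrix.trace (X Kstar * Sig) ≤ Matrix.trace (X K * Sig))
    -- `Kc` solves the gradient flow `K' = −∇f(K)`, `K(0) = K₀`, staying in `S`
    (K₀ : Matrix (Fin m) (Fin n) ℝ) (hK₀ : IsSchur (A - B * K₀))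
    (Kc : ℝ → Matrix (Fin m) (Fin n) ℝ) (hKc0 : Kc 0 = K₀)
    (hKcS : ∀ t ∈ Set.Ici (0 : ℝ), IsSchur (A - B * Kc t))
    (hKc : ∀ t ∈ Set.Ici (0 : ℝ),
      HasDerivWithinAt Kc
        (-((2 : ℝ) • ((R * Kc t - Bᵀ * X (Kc t) * (A - B * Kc t)) * Y (Kc t))))
        (Set.Ici (0 : ℝ)) t) :
    ∃ c > (0 : ℝ), ∃ α > (0 : ℝ), ∀ t ∈ Set.Ici (0 : ℝ),
      frobNorm (Kc t - Kstar) ^ 2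
        ≤ c * Real.exp (-α * t) * frobNorm (K₀ - Kstar) ^ 2 := by
  set E : Matrix (Fin m) (Fin n) ℝ → Matrix (Fin m) (Fin n) ℝ :=
    fun K => R * K - Bᵀ * X K * (A - B * K) with hEdef
  set H : Matrix (Fin m) (Fin n) ℝ → Matrix (Fin m) (Fin m) ℝ :=
    fun K => R + Bᵀ * X K * B with hHdef
  have hRt : Rᵀ = R := hR.isHermitian
  obtain ⟨r, hr, hRr⟩ := hR.exists_posSemidef_sub_smul_one
  obtain ⟨s, hs, hSs⟩ := hSig.exists_posSemidef_sub_smul_one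
  have hXpsd : ∀ K, IsSchur (A - B * K) → (X K).PosSemidef := fun K hK => by
    refine hK.transpose.posSemidef_of_lyapunov (W := Kᵀ * R * K + Q)
      ((hR.posSemidef.conjTranspose_mul_mul_same K).add hQ.posSemidef) ?_
    rw [transpose_transpose, ← add_assoc, hX K hK]
  have hYpsd : ∀ K, IsSchur (A - B * K) → (Y K).PosSemidef := fun K hK =>
    hK.posSemidef_of_lyapunov hSig.posSemidef (hY K hK)
  have hYs : ∀ K, IsSchur (A - B * K) →
      (Y K - s • (1 : Matrix (Fin n) (Fin n) ℝ)).PosSemidef := fun K hK => by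
    have h := ((hYpsd K hK).mul_mul_conjTranspose_same (A - B * K)).add hSs
    rwa [conjTranspose_eq_transpose_of_trivial, add_sub, hY K hK] at h
  have hHr : ∀ K, IsSchur (A - B * K) →
      (H K - r • (1 : Matrix (Fin m) (Fin m) ℝ)).PosSemidef := fun K hK => by
    have h := hRr.add ((hXpsd K hK).conjTranspose_mul_mul_same B)
    rwa [conjTranspose_eq_transpose_of_trivial, sub_add_eq_add_sub] at h
  have hdiff : ∀ K K', IsSchur (A - B * K) → IsSchur (A - B * K') →
      trace (X K' * Sig) - trace (X K * Sig)
        = trace (((K' - K)ᵀ * E K + (E K)ᵀ * (K' - K) + (K' - K)ᵀ * H K * (K' - K)) * Y K') := by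
    intro K K' hK hK'
    have hM : A - B * K - B * (K' - K) = A - B * K' := by
      rw [Matrix.mul_sub]
      abel
    exact lqr_cost_sub hRt (hXpsd K hK).isHermitian (hX K hK)
      (by rw [hM, add_sub_cancel, hX K' hK']) (by rw [hM, hY K' hK'])
  have hEstar : E Kstar = 0 := by
    refine lqr_gradient_eq_zero (H := H Kstar) hs ?_ ?_
    · exact hR.isHermitian.add
        (isHermitian_conjTranspose_mul_mul B (hXpsd _ hKstar).isHermitian)
    · have hc : Continuous fun ε : ℝ => A - B * (Kstar + -ε • E Kstar) := by fun_prop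
      have h0 : ∀ᶠ N in 𝓝 (A - B * (Kstar + -(0 : ℝ) • E Kstar)), IsSchur N := by
        simpa using hKstar.eventually
      filter_upwards [(hc.tendsto 0).eventually h0] with ε hε
      refine ⟨_, hYs _ hε, ?_⟩
      have h := hdiff _ _ hKstar hε
      rw [add_sub_cancel_left] at h
      rw [← h]
      exact sub_nonneg.2 (hmin _ hε)
  have hgrowth : ∀ K, IsSchur (A - B * K) →
      r * s * frobNorm (K - Kstar) ^ 2 ≤ trace (X K * Sig) - trace (X Kstar * Sig) := by
    intro K hK
    rw [hdiff _ _ hKstar hK, hEstar, frobNorm_sq]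
    simpa using smul_trace_le_trace_mul hr.le hs.le (hHr _ hKstar) (hYs K hK) (K - Kstar)
  obtain ⟨y, hy, hYy⟩ := (hYpsd _ hKstar).isHermitian.exists_posSemidef_smul_one_sub
  have hPL : ∀ K, IsSchur (A - B * K) →
      r * s ^ 2 / y * (trace (X K * Sig) - trace (X Kstar * Sig))
        ≤ trace ((E K * Y K)ᵀ * (E K * Y K)) := by
    intro K hK
    have h1 := neg_trace_le_of_posSemidef hr (hHr K hK) (hYpsd _ hKstar) hYy (E K) (Kstar - K)
    rw [← hdiff _ _ hK hKstar, neg_sub] at h1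
    refine le_trans ?_ (sq_mul_trace_le_trace_mul hs.le (hYs K hK) (E K))
    calc _ ≤ r * s ^ 2 / y * (r⁻¹ * y * trace ((E K)ᵀ * E K)) :=
          mul_le_mul_of_nonneg_left h1 (by positivity)
      _ = s ^ 2 * trace ((E K)ᵀ * E K) := by field_simp
  set g : ℝ → ℝ := fun t => trace (X (Kc t) * Sig) - trace (X Kstar * Sig) with hgdef
  have hKcont : ContinuousOn Kc (Set.Ici 0) := fun t ht => (hKc t ht).continuousWithinAt
  have hYcont : ContinuousOn (fun t => Y (Kc t)) (Set.Ici 0) :=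
    continuousOn_lyapunov (continuousOn_const.sub
      ((Continuous.matrix_mul continuous_const continuous_id).comp_continuousOn hKcont))
      hKcS fun t ht => hY _ (hKcS t ht)
  have hgderiv : ∀ t ∈ Set.Ici (0 : ℝ), HasDerivWithinAt g
      (-4 * trace ((E (Kc t) * Y (Kc t))ᵀ * (E (Kc t) * Y (Kc t)))) (Set.Ici 0) t := by
    intro t ht
    have h := hasDerivWithinAt_of_trace_increment (g := g) (E := E (Kc t)) (H := H (Kc t))
      (hKc t ht) (hYcont t ht) fun u hu => by
        rw [← hdiff _ _ (hKcS t ht) (hKcS u hu)]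
        simp only [hgdef]
        ring
    convert h using 1
    change _ = trace (((-((2 : ℝ) • (E (Kc t) * Y (Kc t))))ᵀ * E (Kc t)
      + (E (Kc t))ᵀ * -((2 : ℝ) • (E (Kc t) * Y (Kc t)))) * Y (Kc t))
    have hYt : (Y (Kc t))ᵀ = Y (Kc t) := (hYpsd _ (hKcS t ht)).isHermitian
    have h1 : trace ((E (Kc t))ᵀ * (E (Kc t) * (Y (Kc t) * Y (Kc t))))
        = trace (Y (Kc t) * ((E (Kc t))ᵀ * (E (Kc t) * Y (Kc t)))) := by
      rw [Matrix.trace_mul_comm (Y (Kc t))]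
      simp only [Matrix.mul_assoc]
    simp only [transpose_neg, transpose_smul, transpose_mul, hYt, Matrix.add_mul, Matrix.neg_mul,
      Matrix.mul_neg, Matrix.smul_mul, Matrix.mul_smul, trace_add, trace_neg, trace_smul,
      smul_eq_mul, Matrix.mul_assoc, h1]
    ring
  have hdecay : ∀ t ∈ Set.Ici (0 : ℝ), g t ≤ Real.exp (-(4 * (r * s ^ 2 / y)) * t) * g 0 :=
    fun t ht => le_exp_mul_of_hasDerivWithinAt_le hgderiv
      (fun u hu => by linarith [hPL _ (hKcS u hu)]) ht
  obtain ⟨c, hc, hc0⟩ : ∃ c > (0 : ℝ), g 0 ≤ c * frobNorm (K₀ - Kstar) ^ 2 := by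
    by_cases hK : K₀ = Kstar
    · exact ⟨1, one_pos, by simp [hgdef, hKc0, hK, frobNorm]⟩
    · have h0 : 0 < frobNorm (K₀ - Kstar) ^ 2 := by
        rw [frobNorm_sq, ← conjTranspose_eq_transpose_of_trivial]
        refine (posSemidef_conjTranspose_mul_self _).trace_nonneg.lt_of_ne' fun h => hK ?_
        exact sub_eq_zero.1 (trace_conjTranspose_mul_self_eq_zero_iff.1 h)
      have h1 : 0 < g 0 := by
        have h := hgrowth K₀ hK₀
        simp only [hgdef, hKc0]
        exact (by positivity : 0 < r * s * frobNorm (K₀ - Kstar) ^ 2).trans_le h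
      exact ⟨g 0 / frobNorm (K₀ - Kstar) ^ 2, div_pos h1 h0, by rw [div_mul_cancel₀ _ h0.ne']⟩
  refine ⟨c / (r * s), by positivity, 4 * (r * s ^ 2 / y), by positivity, fun t ht => ?_⟩
  have h1 := (hgrowth _ (hKcS t ht)).trans ((hdecay t ht).trans
    (mul_le_mul_of_nonneg_left hc0 (Real.exp_pos _).le))
  rw [div_mul_eq_mul_div, div_mul_eq_mul_div, le_div_iff₀ (by positivity)]
  linarith
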